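/- Let r ≥ 1 and let 0 ≤ n_1 ≤ n_2 ≤ ⋯ ≤ n_r be integers. Then φ*(n_1, n_2, …, n_r) = Σ_{(d_1,…,d_r) ∈ D_r} Π_{i=1}^r C(n_i + 1, d_i), where arguments equal to 0 correspond to empty runs. -/

import Mathlib

/-- A pairing of the positions `Fin N`: a collection of blocks, each of size 2,
with every position in exactly one block. -/
def IsPairing {N : ℕ} (π : Finset (Finset (Fin N))) : Prop :=
  (∀ B ∈ π, B.card = 2) ∧ ∀ i : Fin N, ∃! B, B ∈ π ∧ i ∈ B

/-- A crossing: blocks `{i₁,i₂}` and `{j₁,j₂}` with `i₁ < j₁ < i₂ < j₂`. -/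
def HasCrossing {N : ℕ} (π : Finset (Finset (Fin N))) : Prop :=
  ∃ B ∈ π, ∃ C ∈ π, ∃ i₁ i₂ j₁ j₂ : Fin N,
    i₁ ∈ B ∧ i₂ ∈ B ∧ j₁ ∈ C ∧ j₂ ∈ C ∧ i₁ < j₁ ∧ j₁ < i₂ ∧ i₂ < j₂

/-- A non-crossing `w`-pairing: a non-crossing pairing of the positions of the
bitstring `w` (ones are `true`, zeros are `false`) pairing unequal letters. -/
def IsNCPairingOn (w : List Bool) (π : Finset (Finset (Fin w.length))) : Prop :=
  IsPairing π ∧ ¬ HasCrossing π ∧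
    ∀ B ∈ π, ∀ i ∈ B, ∀ j ∈ B, i ≠ j → w.get i ≠ w.get j

/-- `phi w` is the number of non-crossing `w`-pairings. -/
noncomputable def phi (w : List Bool) : ℕ :=
  Set.ncard {π : Finset (Finset (Fin w.length)) | IsNCPairingOn w π}

/-- The word `1^{n 0} 0^{m 0} 1^{n 1} 0^{m 1} ⋯ 1^{n (r-1)} 0^{m (r-1)}`. -/
def runsF {r : ℕ} (n m : Fin r → ℕ) : List Bool :=
  (List.finRange r).flatMap fun i => List.replicate (n i) true ++ List.replicate (m i) false

/-- The word `1^{k₁} 0^{k₁} ⋯ 1^{k_r} 0^{k_r}` for `l = [k₁, …, k_r]`. -/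
def symWord (l : List ℕ) : List Bool :=
  l.flatMap fun k => List.replicate k true ++ List.replicate k false

/-- The symmetrized pairing function `φ*(n₁,…,n_r) = φ(1^{n₁}0^{n₁}⋯1^{n_r}0^{n_r})`. -/
noncomputable def phiStar (l : List ℕ) : ℕ := phi (symWord l)

/-- `Yval w i` is the lattice-path value `Y_i`. -/
def Yval (w : List Bool) (i : ℕ) : ℤ :=
  ((w.take i).count true : ℤ) - ((w.take i).count false : ℤ)

/-- The height of position `i` of `w`, relative to the minimum `mY` of the `Y_i`. -/
def heightAt (w : List Bool) (mY : ℤ) (i : Fin w.length) : ℤ :=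
  if w.get i then Yval w (i.val + 1) - mY else Yval w (i.val + 1) - mY + 1

/-- `d : Fin r → ℕ` is a Catalan degree sequence of order `r`. -/
def IsCatalanSeq (r : ℕ) (d : Fin r → ℕ) : Prop :=
  (∀ i : ℕ, 1 ≤ i → i ≤ r - 1 →
      (i : ℕ) ≤ ∑ j ∈ Finset.univ.filter (fun j : Fin r => (j : ℕ) < i), d j) ∧
  ∑ j, d j = r - 1

/-- Sum of the first `j` values of `f`. -/
def prefSum {r : ℕ} (f : Fin r → ℕ) (j : ℕ) : ℕ :=
  ∑ i ∈ Finset.univ.filter (fun i : Fin r => (i : ℕ) < j), f i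

/-- `m` is a member of `CF(n)`. -/
def InCF {r : ℕ} (n m : Fin r → ℕ) : Prop :=
  (∀ j : ℕ, 1 ≤ j → j ≤ r - 1 → prefSum m j ≤ prefSum n j) ∧
  (∑ i, m i = ∑ i, n i)

/-- The condition defining non-crossing pairings of the positions `a, …, a + k - 1` of an
ambient `Fin N`, with letters given by `f`. -/
def IsNCOn (N : ℕ) (f : ℕ → Bool) (a k : ℕ) (π : Finset (Finset (Fin N))) : Prop :=
  (∀ B ∈ π, ∃ x y : Fin N, x < y ∧ a ≤ x.val ∧ y.val < a + k ∧ f x ≠ f y ∧ B = {x, y}) ∧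
  (∀ i : Fin N, a ≤ i.val → i.val < a + k → ∃ B ∈ π, i ∈ B) ∧
  (∀ i : Fin N, ∀ B ∈ π, ∀ C ∈ π, i ∈ B → i ∈ C → B = C) ∧ ¬ HasCrossing π

open Classical in
/-- The number of non-crossing pairings of the positions `a, …, a + k - 1`. -/
noncomputable def ncCount (N : ℕ) (f : ℕ → Bool) (a k : ℕ) : ℕ :=
  (Finset.univ.filter (IsNCOn N f a k)).card

theorem phi_eq_ncCount (w : List Bool) :
    phi w = ncCount w.length (fun i => w.getD i false) 0 w.length := by
  classical
  unfold phi ncCount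
  rw [← Set.ncard_coe_finset]
  congr 1
  ext π
  have hg : ∀ i : Fin w.length, w.getD i.val false = w.get i := by
    intro i; simp
  simp only [Set.mem_ofPred_eq, Finset.coe_filter, Finset.mem_univ, true_and]
  constructor
  · rintro ⟨⟨h1, h2⟩, h3, h4⟩
    refine ⟨?_, ?_, ?_, h3⟩
    · intro B hB
      obtain ⟨x, y, hxy, rfl⟩ := Finset.card_eq_two.1 (h1 B hB)
      rcases lt_or_gt_of_ne hxy with h | h
      · refine ⟨x, y, h, by simp, by simp, ?_, rfl⟩
        beta_reduce
        rw [hg, hg]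
        exact h4 _ hB x (by simp) y (by simp) hxy
      · refine ⟨y, x, h, by simp, by simp, ?_, Finset.pair_comm _ _⟩
        beta_reduce
        rw [hg, hg]
        exact h4 _ hB y (by simp) x (by simp) hxy.symm
    · intro i _ _
      obtain ⟨B, hB, -⟩ := h2 i
      exact ⟨B, hB⟩
    · intro i B hB C hC hiB hiC
      exact (h2 i).unique ⟨hB, hiB⟩ ⟨hC, hiC⟩
  · rintro ⟨h1, h2, h3, h4⟩
    refine ⟨⟨?_, ?_⟩, h4, ?_⟩
    · intro B hB
      obtain ⟨x, y, hxy, -, -, -, rfl⟩ := h1 B hB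
      exact Finset.card_pair hxy.ne
    · intro i
      obtain ⟨B, hB, hi⟩ := h2 i (by simp) (by simp)
      exact ⟨B, ⟨hB, hi⟩, fun C hC => h3 i C hC.1 B hB hC.2 hi⟩
    · intro B hB i hi j hj hij
      obtain ⟨x, y, hxy, -, -, hf, rfl⟩ := h1 B hB
      beta_reduce at hf
      rw [hg, hg] at hf
      simp only [Finset.mem_insert, Finset.mem_singleton] at hi hj
      rcases hi with rfl | rfl <;> rcases hj with rfl | rfl
      · exact absurd rfl hij
      · exact hf
      · exact hf.symm
      · exact absurd rfl hij

theorem ncCount_zero (N : ℕ) (f : ℕ → Bool) (a : ℕ) : ncCount N f a 0 = 1 := by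
  classical
  unfold ncCount
  rw [Finset.card_eq_one]
  refine ⟨∅, ?_⟩
  ext π
  simp only [Finset.mem_filter, Finset.mem_univ, true_and, Finset.mem_singleton]
  constructor
  · rintro ⟨h1, -⟩
    refine Finset.eq_empty_of_forall_notMem fun B hB => ?_
    obtain ⟨x, y, hxy, hx, hy, -⟩ := h1 B hB
    have : x.val < y.val := hxy
    omega
  · rintro rfl
    refine ⟨by simp, ?_, by simp, by simp [HasCrossing]⟩
    intro i h1 h2
    omega

/-- Bounds on the elements of a block. -/
theorem IsNCOn.bounds {N : ℕ} {f : ℕ → Bool} {a k : ℕ} {π : Finset (Finset (Fin N))}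
    (h : IsNCOn N f a k π) {B : Finset (Fin N)} (hB : B ∈ π) {i : Fin N} (hi : i ∈ B) :
    a ≤ i.val ∧ i.val < a + k := by
  obtain ⟨x, y, hxy, hx, hy, -, rfl⟩ := h.1 B hB
  have : x.val < y.val := hxy
  simp only [Finset.mem_insert, Finset.mem_singleton] at hi
  rcases hi with rfl | rfl <;> omega

theorem IsNCOn.nonempty {N : ℕ} {f : ℕ → Bool} {a k : ℕ} {π : Finset (Finset (Fin N))}
    (h : IsNCOn N f a k π) {B : Finset (Fin N)} (hB : B ∈ π) : B.Nonempty := by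
  obtain ⟨x, y, -, -, -, -, rfl⟩ := h.1 B hB
  exact ⟨x, by simp⟩

theorem IsNCOn.join {N : ℕ} {f : ℕ → Bool} {k i : ℕ} {π σ : Finset (Finset (Fin N))}
    {s p : Fin N} (hp : p.val = s.val + 1 + i) (hi : i < k) (hf : f p ≠ f s)
    (hπ : IsNCOn N f (s.val + 1) i π) (hσ : IsNCOn N f (s.val + i + 2) (k - 1 - i) σ) :
    IsNCOn N f s.val (k + 1) (insert {s, p} (π ∪ σ)) := by
  have bπ := fun B hB j => hπ.bounds (B := B) hB (i := j)
  have bσ := fun B hB j => hσ.bounds (B := B) hB (i := j)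
  refine ⟨?_, ?_, ?_, ?_⟩
  · intro B hB
    simp only [Finset.mem_insert, Finset.mem_union] at hB
    rcases hB with rfl | hB | hB
    · exact ⟨s, p, by rw [Fin.lt_def]; omega, le_rfl, by omega, hf.symm, rfl⟩
    · obtain ⟨x, y, hxy, hx, hy, h⟩ := hπ.1 B hB
      exact ⟨x, y, hxy, by omega, by omega, h⟩
    · obtain ⟨x, y, hxy, hx, hy, h⟩ := hσ.1 B hB
      exact ⟨x, y, hxy, by omega, by omega, h⟩
  · intro j h1 h2
    by_cases hjs : j = s
    · exact ⟨{s, p}, by simp, by simp [hjs]⟩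
    by_cases hjp : j = p
    · exact ⟨{s, p}, by simp, by simp [hjp]⟩
    have h3 : j.val ≠ s.val := fun h => hjs (Fin.ext h)
    have h4 : j.val ≠ p.val := fun h => hjp (Fin.ext h)
    rcases lt_or_gt_of_ne h4 with h | h
    · obtain ⟨B, hB, hj⟩ := hπ.2.1 j (by omega) (by omega)
      exact ⟨B, by simp [hB], hj⟩
    · obtain ⟨B, hB, hj⟩ := hσ.2.1 j (by omega) (by omega)
      exact ⟨B, by simp [hB], hj⟩
  · intro j B hB C hC hjB hjC
    have u1 := hπ.2.2.1 j
    have u2 := hσ.2.2.1 j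
    simp only [Finset.mem_insert, Finset.mem_union] at hB hC
    rcases hB with rfl | hB | hB <;> rcases hC with rfl | hC | hC
    · rfl
    · have := bπ _ hC _ hjC
      simp only [Finset.mem_insert, Finset.mem_singleton] at hjB
      rcases hjB with rfl | rfl <;> omega
    · have := bσ _ hC _ hjC
      simp only [Finset.mem_insert, Finset.mem_singleton] at hjB
      rcases hjB with rfl | rfl <;> omega
    · have := bπ _ hB _ hjB
      simp only [Finset.mem_insert, Finset.mem_singleton] at hjC
      rcases hjC with rfl | rfl <;> omega
    · exact u1 B hB C hC hjB hjC
    · have := bπ _ hB _ hjB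
      have := bσ _ hC _ hjC
      omega
    · have := bσ _ hB _ hjB
      simp only [Finset.mem_insert, Finset.mem_singleton] at hjC
      rcases hjC with rfl | rfl <;> omega
    · have := bσ _ hB _ hjB
      have := bπ _ hC _ hjC
      omega
    · exact u2 B hB C hC hjB hjC
  · rintro ⟨B, hB, C, hC, i₁, i₂, j₁, j₂, h1, h2, h3, h4, h5, h6, h7⟩
    rw [Fin.lt_def] at h5 h6 h7
    simp only [Finset.mem_insert, Finset.mem_union] at hB hC
    rcases hB with rfl | hB | hB <;> rcases hC with rfl | hC | hC
    · simp only [Finset.mem_insert, Finset.mem_singleton] at h1 h2 h3 h4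
      rcases h1 with rfl | rfl <;> rcases h2 with rfl | rfl <;> rcases h3 with rfl | rfl <;>
        rcases h4 with rfl | rfl <;> omega
    · have := bπ _ hC _ h3
      have := bπ _ hC _ h4
      simp only [Finset.mem_insert, Finset.mem_singleton] at h1 h2
      rcases h1 with rfl | rfl <;> rcases h2 with rfl | rfl <;> omega
    · have := bσ _ hC _ h3
      have := bσ _ hC _ h4
      simp only [Finset.mem_insert, Finset.mem_singleton] at h1 h2
      rcases h1 with rfl | rfl <;> rcases h2 with rfl | rfl <;> omega
    · have := bπ _ hB _ h1
      have := bπ _ hB _ h2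
      simp only [Finset.mem_insert, Finset.mem_singleton] at h3 h4
      rcases h3 with rfl | rfl <;> rcases h4 with rfl | rfl <;> omega
    · exact hπ.2.2.2 ⟨B, hB, C, hC, i₁, i₂, j₁, j₂, h1, h2, h3, h4, h5, h6, h7⟩
    · have := bπ _ hB _ h1
      have := bπ _ hB _ h2
      have := bσ _ hC _ h3
      have := bσ _ hC _ h4
      omega
    · have := bσ _ hB _ h1
      have := bσ _ hB _ h2
      simp only [Finset.mem_insert, Finset.mem_singleton] at h3 h4
      rcases h3 with rfl | rfl <;> rcases h4 with rfl | rfl <;> omega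
    · have := bσ _ hB _ h1
      have := bσ _ hB _ h2
      have := bπ _ hC _ h3
      have := bπ _ hC _ h4
      omega
    · exact hσ.2.2.2 ⟨B, hB, C, hC, i₁, i₂, j₁, j₂, h1, h2, h3, h4, h5, h6, h7⟩

/-- Restricting a non-crossing pairing to an interval that is a union of blocks. -/
theorem IsNCOn.restrict {N : ℕ} {f : ℕ → Bool} {a k b l : ℕ} {π : Finset (Finset (Fin N))}
    (h : IsNCOn N f a k π) (hab : a ≤ b) (hbl : b + l ≤ a + k)
    (hcl : ∀ B ∈ π, ∀ i ∈ B, b ≤ i.val → i.val < b + l → ∀ j ∈ B, b ≤ j.val ∧ j.val < b + l) :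
    IsNCOn N f b l (π.filter fun B => ∀ j ∈ B, b ≤ j.val ∧ j.val < b + l) := by
  refine ⟨?_, ?_, ?_, ?_⟩
  · intro B hB
    rw [Finset.mem_filter] at hB
    obtain ⟨x, y, hxy, hx, hy, hf, rfl⟩ := h.1 B hB.1
    exact ⟨x, y, hxy, (hB.2 x (by simp)).1, (hB.2 y (by simp)).2, hf, rfl⟩
  · intro i h1 h2
    obtain ⟨B, hB, hi⟩ := h.2.1 i (by omega) (by omega)
    exact ⟨B, Finset.mem_filter.2 ⟨hB, hcl B hB i hi h1 h2⟩, hi⟩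
  · intro i B hB C hC
    exact h.2.2.1 i B (Finset.mem_filter.1 hB).1 C (Finset.mem_filter.1 hC).1
  · rintro ⟨B, hB, C, hC, r⟩
    exact h.2.2.2 ⟨B, (Finset.mem_filter.1 hB).1, C, (Finset.mem_filter.1 hC).1, r⟩

theorem IsNCOn.exists_join {N : ℕ} {f : ℕ → Bool} {k : ℕ} {τ : Finset (Finset (Fin N))}
    {s : Fin N} (h : IsNCOn N f s.val (k + 1) τ) :
    ∃ (p : Fin N) (i : ℕ), p.val = s.val + 1 + i ∧ i < k ∧ f p ≠ f s ∧
      ∃ π σ, IsNCOn N f (s.val + 1) i π ∧ IsNCOn N f (s.val + i + 2) (k - 1 - i) σ ∧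
        insert {s, p} (π ∪ σ) = τ := by
  obtain ⟨A, hA, hsA⟩ := h.2.1 s le_rfl (by omega)
  obtain ⟨x, p, hxp, hx, hp, hf, rfl⟩ := h.1 A hA
  rw [Fin.lt_def] at hxp
  obtain rfl : s = x := by
    simp only [Finset.mem_insert, Finset.mem_singleton] at hsA
    rcases hsA with rfl | rfl
    · rfl
    · omega
  obtain ⟨i, hi⟩ : ∃ i, p.val = s.val + 1 + i := ⟨p.val - s.val - 1, by omega⟩
  have side : ∀ B ∈ τ, B = {s, p} ∨ (∀ j ∈ B, s.val + 1 ≤ j.val ∧ j.val < s.val + 1 + i) ∨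
      (∀ j ∈ B, s.val + i + 2 ≤ j.val ∧ j.val < s.val + i + 2 + (k - 1 - i)) := by
    intro B hB
    by_cases hBA : B = {s, p}
    · exact Or.inl hBA
    right
    obtain ⟨y, z, hyz, hy, hz, -, rfl⟩ := h.1 B hB
    have ne : ∀ j ∈ ({y, z} : Finset (Fin N)), j.val ≠ s.val ∧ j.val ≠ p.val := by
      intro j hj
      refine ⟨fun e => hBA ?_, fun e => hBA ?_⟩
      · exact h.2.2.1 j _ hB _ hA hj (by simp [Fin.ext e])
      · exact h.2.2.1 j _ hB _ hA hj (by simp [Fin.ext e])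
    have hy' := ne y (by simp)
    have hz' := ne z (by simp)
    have nc : ¬ (y.val < p.val ∧ p.val < z.val) := by
      rintro ⟨c1, c2⟩
      exact h.2.2.2 ⟨_, hA, _, hB, s, p, y, z, by simp, by simp, by simp, by simp,
        by rw [Fin.lt_def]; omega, c1, c2⟩
    rw [Fin.lt_def] at hyz
    simp only [Finset.mem_insert, Finset.mem_singleton, forall_eq_or_imp, forall_eq]
    omega
  refine ⟨p, i, hi, by omega, hf.symm, _, _,
    h.restrict (b := s.val + 1) (l := i) (by omega) (by omega) ?_,
    h.restrict (b := s.val + i + 2) (l := k - 1 - i) (by omega) (by omega) ?_, ?_⟩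
  · intro B hB j hj h1 h2
    rcases side B hB with rfl | h3 | h3
    · simp only [Finset.mem_insert, Finset.mem_singleton] at hj
      rcases hj with rfl | rfl <;> omega
    · exact h3
    · have := h3 j hj
      omega
  · intro B hB j hj h1 h2
    rcases side B hB with rfl | h3 | h3
    · simp only [Finset.mem_insert, Finset.mem_singleton] at hj
      rcases hj with rfl | rfl <;> omega
    · have := h3 j hj
      omega
    · exact h3
  · ext B
    simp only [Finset.mem_insert, Finset.mem_union, Finset.mem_filter]
    constructor
    · rintro (rfl | h1 | h1)
      · exact hA
      · exact h1.1
      · exact h1.1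
    · intro hB
      rcases side B hB with h1 | h1 | h1
      · exact Or.inl h1
      · exact Or.inr (Or.inl ⟨hB, h1⟩)
      · exact Or.inr (Or.inr ⟨hB, h1⟩)

theorem IsNCOn.join_subset {N : ℕ} {f : ℕ → Bool} {i j k : ℕ}
    {π σ π' σ' : Finset (Finset (Fin N))} {s p q : Fin N}
    (hp : p.val = s.val + 1 + i) (hq : q.val = s.val + 1 + j)
    (hπ : IsNCOn N f (s.val + 1) i π) (hσ : IsNCOn N f (s.val + i + 2) (k - 1 - i) σ)
    (hπ' : IsNCOn N f (s.val + 1) j π') (hσ' : IsNCOn N f (s.val + j + 2) (k - 1 - j) σ')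
    (h : insert {s, p} (π ∪ σ) = insert {s, q} (π' ∪ σ')) :
    i = j ∧ π ⊆ π' ∧ σ ⊆ σ' := by
  have hij : i = j := by
    have : {s, p} ∈ insert {s, q} (π' ∪ σ') := by rw [← h]; simp
    simp only [Finset.mem_insert, Finset.mem_union] at this
    rcases this with h1 | h1 | h1
    · have : p ∈ ({s, q} : Finset (Fin N)) := by rw [← h1]; simp
      simp only [Finset.mem_insert, Finset.mem_singleton] at this
      rcases this with rfl | rfl <;> omega
    · have := hπ'.bounds h1 (i := s) (by simp)
      omega
    · have := hσ'.bounds h1 (i := s) (by simp)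
      omega
  subst hij
  refine ⟨rfl, fun B hB => ?_, fun B hB => ?_⟩
  · have : B ∈ insert {s, q} (π' ∪ σ') := by rw [← h]; simp [hB]
    simp only [Finset.mem_insert, Finset.mem_union] at this
    rcases this with rfl | h1 | h1
    · have := hπ.bounds hB (i := s) (by simp)
      omega
    · exact h1
    · obtain ⟨x, hx⟩ := hπ.nonempty hB
      have := hπ.bounds hB hx
      have := hσ'.bounds h1 hx
      omega
  · have : B ∈ insert {s, q} (π' ∪ σ') := by rw [← h]; simp [hB]
    simp only [Finset.mem_insert, Finset.mem_union] at this
    rcases this with rfl | h1 | h1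
    · have := hσ.bounds hB (i := s) (by simp)
      omega
    · obtain ⟨x, hx⟩ := hσ.nonempty hB
      have := hσ.bounds hB hx
      have := hπ'.bounds h1 hx
      omega
    · exact h1

theorem ncCount_succ (N : ℕ) (f : ℕ → Bool) (a k : ℕ) (hN : a + (k + 1) ≤ N) :
    ncCount N f a (k + 1) = ∑ i ∈ Finset.range k, if f (a + 1 + i) ≠ f a then
      ncCount N f (a + 1) i * ncCount N f (a + i + 2) (k - 1 - i) else 0 := by
  classical
  rw [← Finset.sum_filter]
  simp only [ncCount, ← Finset.card_product]
  rw [← Finset.card_sigma]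
  symm
  let pos : ℕ → Fin N := fun j => if h : j < N then ⟨j, h⟩ else ⟨a, by omega⟩
  have hpos : ∀ j, j < N → (pos j).val = j := fun j hj => by simp [pos, hj]
  have hs : (pos a).val = a := hpos a (by omega)
  refine Finset.card_nbij (fun x => insert {pos a, pos (a + 1 + x.1)} (x.2.1 ∪ x.2.2)) ?_ ?_ ?_
  · rintro ⟨i, π, σ⟩ hx
    simp only [Finset.mem_coe, Finset.mem_sigma, Finset.mem_filter, Finset.mem_range,
      Finset.mem_product, Finset.mem_univ, true_and] at hx ⊢
    obtain ⟨⟨hi, hf⟩, h1, h2⟩ := hx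
    have hp : (pos (a + 1 + i)).val = a + 1 + i := hpos _ (by omega)
    have := IsNCOn.join (s := pos a) (p := pos (a + 1 + i)) (by rw [hp, hs]) hi
      (by rw [hp, hs]; exact hf) (by rw [hs]; exact h1) (by rw [hs]; exact h2)
    rwa [hs] at this
  · rintro ⟨i, π, σ⟩ hx ⟨j, π', σ'⟩ hy hxy
    simp only [Finset.coe_sigma, Set.mem_sigma_iff, Finset.mem_coe, Finset.mem_filter,
      Finset.mem_range, Finset.mem_product, Finset.mem_univ, true_and] at hx hy hxy
    obtain ⟨⟨hi, hf⟩, h1, h2⟩ := hx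
    obtain ⟨⟨hj, hf'⟩, h1', h2'⟩ := hy
    have hp : (pos (a + 1 + i)).val = a + 1 + i := hpos _ (by omega)
    have hq : (pos (a + 1 + j)).val = a + 1 + j := hpos _ (by omega)
    rw [← hs] at h1 h2 h1' h2'
    have r1 := IsNCOn.join_subset (by rw [hp, hs]) (by rw [hq, hs]) h1 h2 h1' h2' hxy
    have r2 := IsNCOn.join_subset (by rw [hq, hs]) (by rw [hp, hs]) h1' h2' h1 h2 hxy.symm
    obtain ⟨rfl, h3, h4⟩ := r1
    obtain rfl := h3.antisymm r2.2.1
    obtain rfl := h4.antisymm r2.2.2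
    rfl
  · intro τ hτ
    simp only [Finset.coe_filter, Finset.mem_univ, true_and, Set.mem_ofPred_eq] at hτ
    rw [← hs] at hτ
    obtain ⟨p, i, hp, hi, hf, π, σ, h1, h2, rfl⟩ := hτ.exists_join
    rw [hs] at hp h1 h2 hf
    refine ⟨⟨i, π, σ⟩, ?_, ?_⟩
    · simp only [Finset.coe_sigma, Set.mem_sigma_iff, Finset.mem_coe, Finset.mem_filter,
        Finset.mem_range, Finset.mem_product, Finset.mem_univ, true_and]
      rw [hp] at hf
      exact ⟨⟨hi, hf⟩, h1, h2⟩
    · have : pos (a + 1 + i) = p := Fin.ext (by rw [hpos _ (by omega), hp])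
      simp [this]

theorem ncCount_congr (k : ℕ) : ∀ (N N' : ℕ) (f f' : ℕ → Bool) (a a' : ℕ), a + k ≤ N →
    a' + k ≤ N' → (∀ i < k, f (a + i) = f' (a' + i)) → ncCount N f a k = ncCount N' f' a' k := by
  induction k using Nat.strong_induction_on with
  | _ k ih =>
    intro N N' f f' a a' h h' hf
    obtain _ | k := k
    · rw [ncCount_zero, ncCount_zero]
    rw [ncCount_succ _ _ _ _ h, ncCount_succ _ _ _ _ h']
    refine Finset.sum_congr rfl fun i hi => ?_
    rw [Finset.mem_range] at hi
    have e1 := hf 0 (by omega)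
    have e2 := hf (1 + i) (by omega)
    rw [← add_assoc, ← add_assoc] at e2
    rw [add_zero, add_zero] at e1
    rw [e1, e2, ih i (by omega) N N' f f' (a + 1) (a' + 1) (by omega) (by omega)
      fun j hj => by rw [add_assoc, add_assoc]; exact hf _ (by omega),
      ih (k - 1 - i) (by omega) N N' f f' (a + i + 2) (a' + i + 2) (by omega) (by omega)
      fun j hj => by
        have := hf (i + 2 + j) (by omega)
        rwa [← add_assoc, ← add_assoc, ← add_assoc, ← add_assoc] at this]

theorem phi_nil : phi [] = 1 := by
  rw [phi_eq_ncCount]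
  exact ncCount_zero _ _ _

theorem phi_cons_eq_sum (a : Bool) (w : List Bool) :
    phi (a :: w) = ∑ i ∈ Finset.range w.length,
      if w.getD i false ≠ a then phi (w.take i) * phi (w.drop (i + 1)) else 0 := by
  rw [phi_eq_ncCount, List.length_cons, ncCount_succ _ _ _ _ (by omega)]
  refine Finset.sum_congr rfl fun i hi => ?_
  rw [Finset.mem_range] at hi
  have e : (a :: w).getD (0 + 1 + i) false = w.getD i false := by
    rw [show 0 + 1 + i = i + 1 by omega]; simp
  have e0 : (a :: w).getD 0 false = a := by simp
  rw [e, e0, phi_eq_ncCount (w.take i), phi_eq_ncCount (w.drop (i + 1))]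
  have l1 : (w.take i).length = i := by simp; omega
  have l2 : (w.drop (i + 1)).length = w.length - 1 - i := by simp; omega
  rw [l1, l2]
  congr 2
  · refine ncCount_congr _ _ _ _ _ _ _ (by omega) (by omega) fun j hj => ?_
    rw [show 0 + 1 + j = j + 1 by omega]
    simp [hj]
  · refine ncCount_congr _ _ _ _ _ _ _ (by omega) (by omega) fun j hj => ?_
    rw [show 0 + i + 2 + j = (i + 1 + j) + 1 by omega]
    simp

/-- The convolution of two functions on words: the sum of `f u * g v` over all
factorizations `w = u ++ v`. -/
def conv {α : Type*} (g : List α → ℕ) : (List α → ℕ) → List α → ℕ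
  | f, [] => f [] * g []
  | f, a :: w => f [] * g (a :: w) + conv g (fun u => f (a :: u)) w

/-- `letter c g` sends `c :: v` to `g v` and all other words to `0`. -/
def letter (c : Bool) (g : List Bool → ℕ) : List Bool → ℕ
  | [] => 0
  | a :: v => if a = c then g v else 0

/-- The unit of `conv`. -/
def convOne {α : Type*} : List α → ℕ
  | [] => 1
  | _ :: _ => 0

section conv

variable {α : Type*}

theorem conv_congr {f f' g g' : List α → ℕ} {w : List α}
    (h : ∀ u v, u ++ v = w → f u * g v = f' u * g' v) : conv g f w = conv g' f' w := by
  induction w generalizing f f' with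
  | nil => exact h [] [] rfl
  | cons a w ih =>
    simp only [conv]
    rw [h [] (a :: w) rfl, ih (f := fun u => f (a :: u)) (f' := fun u => f' (a :: u))]
    intro u v huv
    exact h (a :: u) v (by simp [huv])

theorem conv_eq_zero {f g : List α → ℕ} {w : List α}
    (h : ∀ u v, u ++ v = w → f u * g v = 0) : conv g f w = 0 := by
  induction w generalizing f with
  | nil => exact h [] [] rfl
  | cons a w ih =>
    simp only [conv]
    rw [h [] (a :: w) rfl, ih (f := fun u => f (a :: u)), add_zero]
    intro u v huv
    exact h (a :: u) v (by simp [huv])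

theorem conv_add_left (f f' g : List α → ℕ) (w : List α) :
    conv g (fun u => f u + f' u) w = conv g f w + conv g f' w := by
  induction w generalizing f f' with
  | nil => simp only [conv]; ring
  | cons a w ih => simp only [conv]; rw [ih]; ring

theorem conv_mul_left (c : ℕ) (f g : List α → ℕ) (w : List α) :
    conv g (fun u => c * f u) w = c * conv g f w := by
  induction w generalizing f with
  | nil => simp only [conv]; ring
  | cons a w ih => simp only [conv]; rw [ih]; ring

theorem conv_assoc (f g h : List α → ℕ) (w : List α) :
    conv h (conv g f) w = conv (conv h g) f w := by
  induction w generalizing f with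
  | nil => simp only [conv]; ring
  | cons a w ih =>
    simp only [conv]
    rw [conv_add_left, conv_mul_left, ih]
    ring

theorem conv_convOne_left (g : List α → ℕ) (w : List α) : conv g convOne w = g w := by
  cases w with
  | nil => simp [conv, convOne]
  | cons a w =>
    simp only [conv, convOne, one_mul]
    rw [conv_eq_zero (by simp), add_zero]

theorem conv_convOne_right (f : List α → ℕ) (w : List α) : conv convOne f w = f w := by
  induction w generalizing f with
  | nil => simp [conv, convOne]
  | cons a w ih => simp [conv, convOne, ih]

theorem conv_eq_sum (f g : List α → ℕ) (w : List α) :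
    conv g f w = ∑ i ∈ Finset.range (w.length + 1), f (w.take i) * g (w.drop i) := by
  induction w generalizing f with
  | nil => simp [conv]
  | cons a w ih =>
    rw [List.length_cons, Finset.sum_range_succ']
    simp only [conv, ih, List.take_succ_cons, List.drop_succ_cons, List.take_zero, List.drop_zero]
    ring

end conv

theorem letter_conv (c : Bool) (f g : List Bool → ℕ) (w : List Bool) :
    letter c (conv g f) w = conv g (letter c f) w := by
  cases w with
  | nil => simp [conv, letter]
  | cons a w =>
    simp only [conv, letter, zero_mul, zero_add]
    split_ifs with h
    · rfl
    · rw [conv_eq_zero (by simp)]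

theorem conv_letter_append (c : Bool) (f g : List Bool → ℕ) (x y : List Bool) :
    conv (letter c g) f (x ++ y) = conv (letter c fun v => g (v ++ y)) f x +
      conv (letter c g) (fun u => f (x ++ u)) y := by
  induction x generalizing f with
  | nil => simp [conv, letter]
  | cons a x ih => simp [conv, letter, ih, add_assoc]

theorem phi_cons (a : Bool) (w : List Bool) : phi (a :: w) = conv (letter (!a) phi) phi w := by
  rw [phi_cons_eq_sum, conv_eq_sum, Finset.sum_range_succ]
  rw [List.drop_length, letter, mul_zero, add_zero]
  refine Finset.sum_congr rfl fun i hi => ?_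
  rw [Finset.mem_range] at hi
  rw [List.drop_eq_getElem_cons hi, List.getD_eq_getElem _ _ hi]
  simp only [letter]
  cases w[i] <;> cases a <;> simp

theorem phi_append_singleton (a : Bool) (w : List Bool) :
    phi (w ++ [a]) = conv (letter (!a) phi) phi w := by
  induction h : w.length using Nat.strong_induction_on generalizing w with
  | _ m ih =>
    obtain _ | ⟨b, w⟩ := w
    · simp [phi_cons, conv, letter]
    rw [List.cons_append, phi_cons, conv_letter_append]
    have e1 : conv (letter (!b) fun v => phi (v ++ [a])) phi w =
        conv (letter (!b) (conv (letter (!a) phi) phi)) phi w := by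
      refine conv_congr fun u v huv => ?_
      obtain _ | ⟨c, v⟩ := v
      · rfl
      simp only [letter]
      rw [ih v.length (by rw [← h, ← huv]; simp; omega) v rfl]
    have e2 : conv (letter (!b) phi) (fun u => phi (w ++ u)) [a] =
        letter (!a) phi (b :: w) := by
      cases a <;> cases b <;> simp [conv, letter, phi_nil]
    have e3 : conv (letter (!a) phi) (fun u => phi (b :: u)) w =
        conv (letter (!a) phi) (conv (letter (!b) phi) phi) w :=
      conv_congr fun u v _ => by rw [phi_cons]
    have e4 : conv (letter (!b) (conv (letter (!a) phi) phi)) phi w =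
        conv (conv (letter (!a) phi) (letter (!b) phi)) phi w :=
      conv_congr fun u v _ => by rw [letter_conv]
    rw [e1, e2]
    simp only [conv, phi_nil, one_mul]
    rw [e3, conv_assoc, e4, add_comm]

theorem phi_append_comm (u v : List Bool) : phi (u ++ v) = phi (v ++ u) := by
  induction u generalizing v with
  | nil => simp
  | cons a u ih =>
    rw [List.cons_append, phi_cons, ← phi_append_singleton, List.append_assoc, ih]
    simp

/-- Conjugate words have the same number of pairings. -/
theorem phi_eq_of_append_eq (u w z : List Bool) (h : w ++ u = u ++ z) : phi w = phi z := by
  induction hm : u.length using Nat.strong_induction_on generalizing u with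
  | _ m ih =>
    rcases List.append_eq_append_iff.1 h with ⟨x, h1, h2⟩ | ⟨x, h1, h2⟩
    · obtain _ | ⟨a, w⟩ := w
      · have : z = [] := by
          have := congrArg List.length h
          simp at this
          exact this
        rw [this]
      · refine ih x.length ?_ x ?_ rfl
        · rw [← hm, h1]; simp
        · rw [← h2, h1]
    · rw [h1, h2, phi_append_comm]

theorem count_eq_of_phi_ne_zero (w : List Bool) (h : phi w ≠ 0) :
    w.count true = w.count false := by
  induction hm : w.length using Nat.strong_induction_on generalizing w with
  | _ m ih =>
    obtain _ | ⟨a, w⟩ := w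
    · rfl
    by_contra hc
    refine h ?_
    rw [phi_cons]
    refine conv_eq_zero fun u v huv => ?_
    obtain _ | ⟨b, v⟩ := v
    · simp [letter]
    simp only [letter]
    split_ifs with hb
    · by_contra hne
      rw [mul_eq_zero, not_or] at hne
      subst hb huv
      have h1 := ih u.length (by rw [← hm]; simp) u hne.1 rfl
      have h2 := ih v.length (by rw [← hm]; simp; omega) v hne.2 rfl
      cases a <;> simp at hc <;> omega
    · simp

theorem phi_eq_zero_of_count_ne {w : List Bool} (h : w.count true ≠ w.count false) :
    phi w = 0 := by
  by_contra h'
  exact h (count_eq_of_phi_ne_zero w h')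

theorem conv_letter_replicate_true (f g : List Bool → ℕ) (b : ℕ) :
    conv (letter false g) f (List.replicate b true) = 0 := by
  refine conv_eq_zero fun u v huv => ?_
  obtain _ | ⟨c, v⟩ := v
  · simp [letter]
  have : c = true := List.eq_of_mem_replicate (n := b) (by rw [← huv]; simp)
  simp [letter, this]

theorem conv_letter_replicate_false (f g : List Bool → ℕ) (b j : ℕ)
    (hf : ∀ i, i ≠ j → f (List.replicate i false) = 0) :
    conv (letter false g) f (List.replicate b false) =
      if j < b then f (List.replicate j false) * g (List.replicate (b - 1 - j) false) else 0 := by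
  induction b generalizing f j with
  | zero => simp [conv, letter]
  | succ b ih =>
    simp only [List.replicate_succ, conv, letter, if_true]
    obtain _ | j := j
    · rw [conv_eq_zero]
      · simp
      · intro u v huv
        obtain ⟨hu, -⟩ := List.append_eq_replicate_iff.1 huv |>.2
        rw [hu, ← List.replicate_succ, hf _ (by omega), zero_mul]
    · have h0 := hf 0 (by omega)
      rw [List.replicate_zero] at h0
      rw [h0, zero_mul, zero_add, ih (fun u => f (false :: u)) j]
      · simp only [add_lt_add_iff_right, List.replicate_succ]
        congr 4
        omega
      · intro i hi
        rw [← List.replicate_succ]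
        exact hf _ (by omega)

theorem symWord_nil : symWord [] = [] := rfl

theorem symWord_cons (b : ℕ) (B : List ℕ) :
    symWord (b :: B) = List.replicate b true ++ (List.replicate b false ++ symWord B) := by
  simp [symWord]

theorem symWord_append (B C : List ℕ) : symWord (B ++ C) = symWord B ++ symWord C := by
  simp [symWord]

theorem count_symWord (c : Bool) (B : List ℕ) : (symWord B).count c = B.sum := by
  induction B with
  | nil => simp [symWord_nil]
  | cons b B ih => cases c <;> simp [symWord_cons, ih, List.count_replicate]

theorem rdrop_append_replicate (x : List Bool) (i : ℕ) :
    (x ++ List.replicate i false).rdrop i = x := by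
  simp [List.rdrop]

/-- Words `0^n` followed by blocks of size at least `n` end in `0^n`. -/
theorem exists_append_replicate (n : ℕ) (B : List ℕ) (hB : ∀ b ∈ B, n ≤ b) (x : List Bool)
    {j : ℕ} (hj : j ≤ n) :
    ∃ y, x ++ List.replicate n false ++ symWord B = y ++ List.replicate j false := by
  rcases List.eq_nil_or_concat B with rfl | ⟨C, b, rfl⟩
  · refine ⟨x ++ List.replicate (n - j) false, ?_⟩
    rw [symWord_nil, List.append_nil, List.append_assoc, ← List.replicate_add]
    congr 2
    omega
  · have hb := hB b (by simp)
    refine ⟨x ++ List.replicate n false ++ symWord C ++ List.replicate b true ++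
      List.replicate (b - j) false, ?_⟩
    rw [List.concat_eq_append, symWord_append, symWord_cons, symWord_nil]
    simp only [List.append_assoc, List.append_nil, ← List.replicate_add]
    congr 5
    omega

/-- Cutting a word of blocks at the zeros of a fixed height. -/
theorem conv_phi_symWord (m i : ℕ) (k : List ℕ → ℕ) (h : List Bool → ℕ)
    (hk : ∀ C, (∀ c ∈ C, m + 1 + i ≤ c) → k C = h (List.replicate i false ++ symWord C)) (C B : List ℕ)
    (hB : ∀ b ∈ B, m + 1 + i ≤ b) :
    conv (letter false h) (fun u => phi (List.replicate m true ++
        List.replicate (m + 1 + i) false ++ symWord C ++ u)) (symWord B) +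
      phi ((List.replicate m true ++ List.replicate (m + 1 + i) false ++
        symWord C).rdrop (i + 1)) * k B =
    conv k (fun D => phi ((List.replicate m true ++ List.replicate (m + 1 + i) false ++
        symWord (C ++ D)).rdrop (i + 1))) B := by
  induction B generalizing C with
  | nil => simp [conv, letter, symWord_nil]
  | cons b B ih =>
    have hb := hB b (by simp)
    have ih' := ih (C ++ [b]) fun b' hb' => hB b' (by simp [hb'])
    have e : ∀ D, C ++ [b] ++ D = C ++ b :: D := fun D => by simp
    simp only [conv, List.append_nil, e] at ih' ⊢
    rw [← ih', symWord_cons, conv_letter_append, conv_letter_replicate_true, zero_add,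
      conv_letter_append, conv_letter_replicate_false _ _ _ (b - 1 - i)]
    · have e1 : symWord (C ++ [b]) = symWord C ++ (List.replicate b true ++
          (List.replicate (b - 1 - i) false ++ List.replicate (i + 1) false)) := by
        rw [symWord_append, symWord_cons, symWord_nil, List.append_nil, ← List.replicate_add,
          show b - 1 - i + (i + 1) = b by omega]
      have e2 : (List.replicate m true ++ List.replicate (m + 1 + i) false ++
          symWord (C ++ [b])).rdrop (i + 1) = List.replicate m true ++
          List.replicate (m + 1 + i) false ++ symWord C ++ (List.replicate b true ++
          List.replicate (b - 1 - i) false) := by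
        rw [e1]
        simp only [← List.append_assoc]
        rw [rdrop_append_replicate]
      rw [e2, hk B fun c hc => hB c (by simp [hc]), if_pos (by omega), show b - 1 - (b - 1 - i) = i by omega]
      have e3 : symWord (C ++ [b]) = symWord C ++ (List.replicate b true ++
          List.replicate b false) := by
        rw [symWord_append, symWord_cons, symWord_nil, List.append_nil]
      rw [e3]
      simp only [List.append_assoc]
      ring
    · intro j hj
      apply phi_eq_zero_of_count_ne
      simp [count_symWord, List.count_replicate]
      omega

/-- The convolution powers of `phiStar`. -/
noncomputable def phiStarPow : ℕ → List ℕ → ℕ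
  | 0 => convOne
  | m + 1 => conv phiStar (phiStarPow m)

theorem phi_eq_phiStarPow (m i : ℕ) (B : List ℕ) (w : List Bool) (hB : ∀ b ∈ B, m + i ≤ b)
    (hw : w ++ List.replicate i false =
      List.replicate m true ++ List.replicate (m + i) false ++ symWord B) :
    phi w = phiStarPow (m + 1) B := by
  induction m generalizing i B w with
  | zero =>
    simp only [phiStarPow]
    rw [conv_convOne_left]
    refine phi_eq_of_append_eq (List.replicate i false) _ _ ?_
    simpa using hw
  | succ m ih =>
    obtain _ | ⟨a, w⟩ := w
    · have := congrArg List.length hw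
      simp at this
      omega
    rw [List.replicate_succ] at hw
    simp only [List.cons_append, List.cons.injEq] at hw
    obtain ⟨rfl, hw⟩ := hw
    rw [phi_cons, Bool.not_true]
    let h : List Bool → ℕ := fun v => phi (v.rdrop i)
    have hk : ∀ C : List ℕ, (∀ c ∈ C, m + 1 + i ≤ c) →
        h (List.replicate i false ++ symWord C) = phiStar C := by
      intro C hC
      obtain ⟨y, hy⟩ := exists_append_replicate i C (fun c hc => by have := hC c hc; omega) [] le_rfl
      simp only [List.nil_append] at hy
      simp only [h, phiStar]
      rw [hy, rdrop_append_replicate]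
      exact phi_eq_of_append_eq _ _ _ hy.symm
    have hcount : w.count true + 1 = w.count false := by
      have h1 := congrArg (List.count true) hw
      have h2 := congrArg (List.count false) hw
      simp [count_symWord, List.count_replicate] at h1 h2
      omega
    have e1 : conv (letter false phi) phi w = conv (letter false h) phi
        (w ++ List.replicate i false) := by
      rw [conv_letter_append]
      have : conv (letter false h) (fun u => phi (w ++ u)) (List.replicate i false) = 0 := by
        refine conv_eq_zero fun u v huv => ?_
        rw [(List.append_eq_replicate_iff.1 huv).2.1, phi_eq_zero_of_count_ne, zero_mul]
        simp [List.count_replicate]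
        omega
      rw [this, add_zero]
      simp only [h, rdrop_append_replicate]
    have e2 : conv (letter false fun v => h (v ++ symWord B)) phi (List.replicate m true ++
        List.replicate (m + 1 + i) false) = phi ((List.replicate m true ++
        List.replicate (m + 1 + i) false ++ symWord []).rdrop (i + 1)) * phiStar B := by
      rw [conv_letter_append, conv_letter_replicate_true, zero_add,
        conv_letter_replicate_false _ _ _ m, if_pos (by omega),
        show m + 1 + i - 1 - m = i by omega, hk B hB, symWord_nil, List.append_nil,
        show m + 1 + i = m + (i + 1) by omega, List.replicate_add, ← List.append_assoc,
        rdrop_append_replicate]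
      intro j hj
      apply phi_eq_zero_of_count_ne
      simp [List.count_replicate]
      omega
    have e3 := conv_phi_symWord m i phiStar h
      (fun C hC => (hk C hC).symm) [] B hB
    rw [symWord_nil, List.append_nil] at e3 e2
    rw [e1, hw, conv_letter_append, e2, add_comm, e3]
    simp only [phiStarPow, List.nil_append]
    refine conv_congr fun D D' hD => ?_
    have hD' : ∀ b ∈ D, m + (1 + i) ≤ b := fun b hb => by
      have := hB b (by rw [← hD]; simp [hb])
      omega
    obtain ⟨y, hy⟩ := exists_append_replicate (m + (1 + i)) D hD' (List.replicate m true)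
      (j := i + 1) (by omega)
    rw [add_assoc m 1 i, hy, rdrop_append_replicate]
    rw [add_comm 1 i] at hy hD'
    rw [ih (i + 1) D y hD' hy.symm]
    rfl

theorem phiStar_cons (n : ℕ) (B : List ℕ) (hB : ∀ b ∈ B, n ≤ b) :
    phiStar (n :: B) = phiStarPow (n + 1) B :=
  phi_eq_phiStarPow n 0 B _ (by simpa using hB) (by simp [symWord_cons])

theorem phiStarPow_add (m k : ℕ) (B : List ℕ) :
    phiStarPow (m + k) B = conv (phiStarPow k) (phiStarPow m) B := by
  induction k generalizing B with
  | zero => exact (conv_convOne_right _ _).symm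
  | succ k ih =>
    rw [← add_assoc]
    simp only [phiStarPow]
    rw [← conv_assoc, funext ih]

theorem phiStarPow_nil (m : ℕ) : phiStarPow m [] = 1 := by
  induction m with
  | zero => rfl
  | succ m ih => simp [phiStarPow, conv, ih, phiStar, symWord_nil, phi_nil]

theorem phiStarPow_succ_cons (m n : ℕ) (B : List ℕ) (hB : (n :: B).Pairwise (· ≤ ·)) :
    phiStarPow (m + 1) (n :: B) = phiStarPow m (n :: B) + phiStarPow (m + 1 + n) B := by
  rw [add_comm m 1, phiStarPow_add]
  simp only [conv]
  rw [phiStarPow_nil, one_mul]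
  congr 1
  rw [show 1 + m + n = n + 1 + m by omega, phiStarPow_add]
  refine conv_congr fun u v huv => ?_
  congr 1
  simp only [phiStarPow]
  rw [conv_convOne_left]
  refine phiStar_cons n u fun b hb => ?_
  exact (List.pairwise_cons.1 hB).1 b (by rw [← huv]; simp [hb])

/-- The weighted number of plane forests with `k` trees whose vertices have, in preorder,
`C(n + 1, d)` possible sets of `d` children for the successive entries `n` of the list. -/
def forestCount : ℕ → List ℕ → ℕ
  | 0, [] => 1
  | _ + 1, [] => 0
  | 0, _ :: _ => 0
  | k + 1, n :: B => ∑ d ∈ Finset.range (n + 2), (n + 1).choose d * forestCount (k + d) B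

theorem forestCount_cons (k n : ℕ) (B : List ℕ) : forestCount (k + 1) (n :: B) =
    ∑ d ∈ Finset.range (n + 2), (n + 1).choose d * forestCount (k + d) B := by
  simp [forestCount]

theorem sum_choose_mul_sum_choose_mul (a b : ℕ) (g : ℕ → ℕ) :
    ∑ i ∈ Finset.range (a + 1), a.choose i *
      ∑ j ∈ Finset.range (b + 1), b.choose j * g (i + j) =
    ∑ t ∈ Finset.range (a + b + 1), (a + b).choose t * g t := by
  induction a generalizing g with
  | zero => simp
  | succ a ih =>
    have step : ∀ (c : ℕ) (h : ℕ → ℕ), ∑ i ∈ Finset.range (c + 1 + 1), (c + 1).choose i * h i =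
        ∑ i ∈ Finset.range (c + 1), c.choose i * (h i + h (i + 1)) := by
      intro c h
      rw [Finset.sum_range_succ']
      simp only [Nat.choose_succ_succ, Nat.choose_zero_right, add_mul, mul_add,
        Finset.sum_add_distrib]
      have : ∑ i ∈ Finset.range (c + 1), c.choose (i + 1) * h (i + 1) + 1 * h 0 =
          ∑ i ∈ Finset.range (c + 1), c.choose i * h i := by
        rw [Finset.sum_range_succ, Finset.sum_range_succ' _ c]
        simp
      rw [← this]
      ring
    rw [step, show a + 1 + b = a + b + 1 by omega, step, ← ih]
    refine Finset.sum_congr rfl fun i _ => ?_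
    rw [← Finset.sum_add_distrib]
    congr 1
    refine Finset.sum_congr rfl fun j _ => ?_
    rw [show i + 1 + j = i + j + 1 by omega]
    ring

theorem phiStarPow_eq_sum (B : List ℕ) (hB : B.Pairwise (· ≤ ·)) (m : ℕ) :
    phiStarPow m B = ∑ d ∈ Finset.range (m + 1), m.choose d * forestCount d B := by
  induction B generalizing m with
  | nil =>
    rw [phiStarPow_nil, Finset.sum_range_succ']
    simp [forestCount]
  | cons n B ih =>
    induction m with
    | zero => simp [phiStarPow, convOne, forestCount]
    | succ m ihm =>
      have hB' := (List.pairwise_cons.1 hB).2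
      rw [phiStarPow_succ_cons m n B hB, ihm, ih hB', show m + 1 + n = m + (n + 1) by omega,
        ← sum_choose_mul_sum_choose_mul]
      simp only [← forestCount_cons]
      rw [Finset.sum_range_succ' _ (m + 1)]
      simp only [Nat.choose_succ_succ, Nat.choose_zero_right, add_mul, Finset.sum_add_distrib]
      have : ∑ i ∈ Finset.range (m + 1), m.choose (i + 1) * forestCount (i + 1) (n :: B) +
          1 * forestCount 0 (n :: B) =
          ∑ i ∈ Finset.range (m + 1), m.choose i * forestCount i (n :: B) := by
        rw [Finset.sum_range_succ, Finset.sum_range_succ' _ m]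
        simp
      rw [← this]
      ring

theorem phiStar_eq_forestCount (B : List ℕ) (hB : B.Pairwise (· ≤ ·)) (hne : B ≠ []) :
    phiStar B = forestCount 1 B := by
  have h := phiStarPow_eq_sum B hB 1
  simp only [phiStarPow] at h
  rw [conv_convOne_left] at h
  obtain _ | ⟨n, B⟩ := B
  · exact absurd rfl hne
  · simp [h, Finset.sum_range_succ, forestCount]

/-- `d` is the preorder degree sequence of a plane forest with `k` trees. -/
def IsForestSeq (k r : ℕ) (d : Fin r → ℕ) : Prop :=
  (∀ i < r, i + 1 ≤ k + ∑ j ∈ Finset.univ.filter (fun j : Fin r => (j : ℕ) < i), d j) ∧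
  k + ∑ j, d j = r

theorem isForestSeq_cons (k r e : ℕ) (d : Fin r → ℕ) :
    IsForestSeq (k + 1) (r + 1) (Fin.cons e d) ↔ IsForestSeq (k + e) r d := by
  have h : ∀ i, ∑ j ∈ Finset.univ.filter (fun j : Fin (r + 1) => (j : ℕ) < i + 1),
      (Fin.cons e d : Fin (r + 1) → ℕ) j =
      e + ∑ j ∈ Finset.univ.filter (fun j : Fin r => (j : ℕ) < i), d j := by
    intro i
    simp only [Finset.sum_filter, Fin.sum_univ_succ]
    simp
  unfold IsForestSeq
  rw [Fin.sum_univ_succ]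
  simp only [Fin.cons_zero, Fin.cons_succ]
  refine and_congr ⟨fun H i hi => ?_, fun H i hi => ?_⟩ (by omega)
  · have := H (i + 1) (by omega)
    rw [h] at this
    omega
  · obtain _ | i := i
    · omega
    · have := H i (by omega)
      rw [h]
      omega

theorem not_isForestSeq_zero_succ (r : ℕ) (d : Fin (r + 1) → ℕ) : ¬ IsForestSeq 0 (r + 1) d := by
  intro h
  have := h.1 0 (by omega)
  simp at this

theorem isCatalanSeq_iff {r : ℕ} (hr : 1 ≤ r) (d : Fin r → ℕ) :
    IsCatalanSeq r d ↔ IsForestSeq 1 r d := by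
  unfold IsCatalanSeq IsForestSeq
  refine and_congr ⟨fun H i hi => ?_, fun H i h1 hi => ?_⟩ (by omega)
  · obtain _ | i := i
    · omega
    · have := H (i + 1) (by omega) (by omega)
      omega
  · have := H i (by omega)
    omega

open Classical in
theorem forestCount_eq_sum (M r k : ℕ) (n : Fin r → ℕ) (hn : ∀ i, n i + 1 < M) :
    forestCount k (List.ofFn n) =
      ∑ d ∈ (Fintype.piFinset fun _ : Fin r => Finset.range M),
        if IsForestSeq k r d then ∏ i, (n i + 1).choose (d i) else 0 := by
  induction r generalizing k with
  | zero =>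
    obtain _ | k := k <;> simp [forestCount, IsForestSeq]
  | succ r ih =>
    rw [List.ofFn_succ]
    obtain _ | k := k
    · simp [forestCount, not_isForestSeq_zero_succ]
    have hsub : Finset.range (n 0 + 2) ⊆ Finset.range M :=
      Finset.range_subset_range.2 (hn 0)
    rw [forestCount_cons, Finset.sum_subset hsub fun d _ hd => by
      rw [Nat.choose_eq_zero_of_lt (by simp at hd; omega), zero_mul]]
    simp only [ih _ (fun i => n i.succ) fun i => hn i.succ, Finset.mul_sum]
    rw [← Finset.sum_product']
    refine Finset.sum_bij' (fun x _ => (Fin.cons x.1 x.2 : Fin (r + 1) → ℕ))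
      (fun d _ => (d 0, Fin.tail d)) ?_ ?_ ?_ ?_ ?_
    · rintro ⟨e, d⟩ hx
      simp only [Finset.mem_product, Fintype.mem_piFinset] at hx ⊢
      exact Fin.cases hx.1 hx.2
    · intro d hd
      simp only [Finset.mem_product, Fintype.mem_piFinset] at hd ⊢
      exact ⟨hd 0, fun i => hd i.succ⟩
    · rintro ⟨e, d⟩ _
      simp
    · intro d _
      simp
    · rintro ⟨e, d⟩ _
      simp only [isForestSeq_cons, Fin.prod_univ_succ, Fin.cons_zero, Fin.cons_succ]
      split_ifs <;> simp

/-- For weakly increasing `n₁ ≤ ⋯ ≤ n_r`,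
`φ*(n₁,…,n_r) = Σ_{d ∈ D_r} Π_i C(n_i + 1, d_i)`. -/
theorem stmt14 (r : ℕ) (hr : 1 ≤ r) (n : Fin r → ℕ) (hmono : Monotone n) :
    phiStar ((List.finRange r).map n) =
      ∑ᶠ d ∈ {d : Fin r → ℕ | IsCatalanSeq r d}, ∏ i, (n i + 1).choose (d i) := by
  classical
  have hM : ∀ i, n i + 1 < r + 2 + ∑ i, n i := fun i => by
    have := Finset.single_le_sum (f := n) (fun _ _ => Nat.zero_le _) (Finset.mem_univ i)
    omega
  rw [← List.ofFn_eq_map, phiStar_eq_forestCount, forestCount_eq_sum _ _ _ _ hM,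
    ← Finset.sum_filter]
  · refine (finsum_mem_eq_sum_of_inter_support_eq _ ?_).symm
    congr 1
    ext d
    simp only [Set.mem_ofPred_eq, Finset.coe_filter, Fintype.mem_piFinset, Finset.mem_range,
      isCatalanSeq_iff hr]
    refine ⟨fun h => ⟨fun i => ?_, h⟩, fun h => h.2⟩
    have h1 := Finset.single_le_sum (f := d) (fun _ _ => Nat.zero_le _) (Finset.mem_univ i)
    have h2 := h.2
    omega
  · rw [List.pairwise_ofFn]
    exact fun i j hij => hmono hij.le
  · intro h
    have := congrArg List.length h
    simp at this
    omega
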